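/- arXiv:0909.4438 — 7 statements merged into one kernel-verified Lean document; each statement's English description precedes it below -/
import Mathlib

section
/- Let W be a module over a ring R and let τ be a map from the set of R-submodules of W to itself such that τ ∘ τ = id and τ(Γ(x,a,y,b,z)) = Γ(τ(z), τ(a), τ(y), τ(b), τ(x)) for all submodules x, a, y, b, z of W. Then for every submodule a of W and all submodules x, y, z fixed by τ (i.e. τ(x) = x, τ(y) = y, τ(z) = z), the submodule Γ(x, a, y, τ(a), z) is again fixed by τ. Moreover, if in addition τ(a) = a, then the induced ternary operation is commutative: Γ(x, a, y, a, z) = Γ(z, a, y, a, x). -/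
/-- The quintary Grassmannian product
`Γ(x,a,y,b,z) = {ω | ∃ ξ ∈ x, α ∈ a, η ∈ y, β ∈ b, ζ ∈ z, ω = ζ+α = ζ+η+ξ = ξ+β}`. -/
def Gamma {R W : Type*} [Ring R] [AddCommGroup W] [Module R W]
    (x a y b z : Submodule R W) : Submodule R W where
  carrier := {ω | ∃ ξ ∈ x, ∃ α ∈ a, ∃ η ∈ y, ∃ β ∈ b, ∃ ζ ∈ z,
    ω = ζ + α ∧ ω = ζ + η + ξ ∧ ω = ξ + β}
  zero_mem' := ⟨0, x.zero_mem, 0, a.zero_mem, 0, y.zero_mem, 0, b.zero_mem, 0, z.zero_mem,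
    by simp, by simp, by simp⟩
  add_mem' := by
    rintro u v ⟨ξ, hξ, α, hα, η, hη, β, hβ, ζ, hζ, h1, h2, h3⟩
      ⟨ξ', hξ', α', hα', η', hη', β', hβ', ζ', hζ', h1', h2', h3'⟩
    exact ⟨ξ + ξ', add_mem hξ hξ', α + α', add_mem hα hα', η + η', add_mem hη hη',
      β + β', add_mem hβ hβ', ζ + ζ', add_mem hζ hζ',
      by rw [h1, h1']; abel, by rw [h2, h2']; abel, by rw [h3, h3']; abel⟩
  smul_mem' := by
    rintro r u ⟨ξ, hξ, α, hα, η, hη, β, hβ, ζ, hζ, h1, h2, h3⟩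
    exact ⟨r • ξ, x.smul_mem r hξ, r • α, a.smul_mem r hα, r • η, y.smul_mem r hη,
      r • β, b.smul_mem r hβ, r • ζ, z.smul_mem r hζ,
      by rw [h1]; rw [smul_add], by rw [h2, smul_add, smul_add], by rw [h3, smul_add]⟩

/-- Composition `G ∘ F` of linear relations on `W`. -/
def relComp {R W : Type*} [Ring R] [AddCommGroup W] [Module R W]
    (G F : Submodule R (W × W)) : Submodule R (W × W) where
  carrier := {p | ∃ v, (p.1, v) ∈ F ∧ (v, p.2) ∈ G}
  zero_mem' := ⟨0, F.zero_mem, G.zero_mem⟩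
  add_mem' := by
    rintro p q ⟨v, hv1, hv2⟩ ⟨w, hw1, hw2⟩
    exact ⟨v + w, F.add_mem hv1 hw1, G.add_mem hv2 hw2⟩
  smul_mem' := by
    rintro r p ⟨v, hv1, hv2⟩
    exact ⟨r • v, F.smul_mem r hv1, G.smul_mem r hv2⟩

/-- Inverse `F⁻¹` of a linear relation. -/
def relInv {R W : Type*} [Ring R] [AddCommGroup W] [Module R W]
    (F : Submodule R (W × W)) : Submodule R (W × W) where
  carrier := {p | (p.2, p.1) ∈ F}
  zero_mem' := F.zero_mem
  add_mem' := fun hp hq => F.add_mem hp hq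
  smul_mem' := fun r _ hp => F.smul_mem r hp

/-- Image `F(z)` of a submodule under a linear relation. -/
def relImage {R W : Type*} [Ring R] [AddCommGroup W] [Module R W]
    (F : Submodule R (W × W)) (z : Submodule R W) : Submodule R W where
  carrier := {w | ∃ v ∈ z, (v, w) ∈ F}
  zero_mem' := ⟨0, z.zero_mem, F.zero_mem⟩
  add_mem' := by
    rintro u u' ⟨v, hv, hF⟩ ⟨v', hv', hF'⟩
    exact ⟨v + v', add_mem hv hv', F.add_mem hF hF'⟩
  smul_mem' := by
    rintro r u ⟨v, hv, hF⟩
    exact ⟨r • v, z.smul_mem r hv, F.smul_mem r hF⟩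

/-- The generalized projection `P_x^a = {(ζ,ω) | ω ∈ x, ω - ζ ∈ a}`. -/
def genProj {R W : Type*} [Ring R] [AddCommGroup W] [Module R W]
    (x a : Submodule R W) : Submodule R (W × W) where
  carrier := {p | p.2 ∈ x ∧ p.2 - p.1 ∈ a}
  zero_mem' := ⟨x.zero_mem, by simp⟩
  add_mem' := by
    rintro p q ⟨h1, h2⟩ ⟨h3, h4⟩
    exact ⟨add_mem h1 h3, by simpa [add_sub_add_comm] using add_mem h2 h4⟩
  smul_mem' := by
    rintro r p ⟨h1, h2⟩
    exact ⟨x.smul_mem r h1, by simpa [smul_sub] using a.smul_mem r h2⟩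

/-- The relation `1 - F = {(v, v - w) | (v,w) ∈ F}`. -/
def oneMinus {R W : Type*} [Ring R] [AddCommGroup W] [Module R W]
    (F : Submodule R (W × W)) : Submodule R (W × W) where
  carrier := {p | ∃ w, (p.1, w) ∈ F ∧ p.2 = p.1 - w}
  zero_mem' := ⟨0, F.zero_mem, by simp⟩
  add_mem' := by
    rintro p q ⟨w, hw, he⟩ ⟨w', hw', he'⟩
    refine ⟨w + w', F.add_mem hw hw', ?_⟩
    show p.2 + q.2 = p.1 + q.1 - (w + w')
    rw [he, he']; abel
  smul_mem' := by
    rintro r p ⟨w, hw, he⟩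
    refine ⟨r • w, F.smul_mem r hw, ?_⟩
    show r • p.2 = r • p.1 - r • w
    rw [he, smul_sub]

/-- The difference `F - G = {(u, α - β) | (u,α) ∈ F, (u,β) ∈ G}` of linear relations. -/
def relSub {R W : Type*} [Ring R] [AddCommGroup W] [Module R W]
    (F G : Submodule R (W × W)) : Submodule R (W × W) where
  carrier := {p | ∃ α β, (p.1, α) ∈ F ∧ (p.1, β) ∈ G ∧ p.2 = α - β}
  zero_mem' := ⟨0, 0, F.zero_mem, G.zero_mem, by simp⟩
  add_mem' := by
    rintro p q ⟨α, β, hα, hβ, he⟩ ⟨α', β', hα', hβ', he'⟩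
    refine ⟨α + α', β + β', F.add_mem hα hα', G.add_mem hβ hβ', ?_⟩
    show p.2 + q.2 = α + α' - (β + β')
    rw [he, he']; abel
  smul_mem' := by
    rintro r p ⟨α, β, hα, hβ, he⟩
    refine ⟨r • α, r • β, F.smul_mem r hα, G.smul_mem r hβ, ?_⟩
    show r • p.2 = r • α - r • β
    rw [he, smul_sub]

/-- `Γ` is invariant under exchanging `x` with `z` and `a` with `b`. -/
theorem Gamma_swap {R W : Type*} [Ring R] [AddCommGroup W] [Module R W]
    (x a y b z : Submodule R W) : Gamma x a y b z = Gamma z b y a x := by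
  have le : ∀ x a y b z : Submodule R W, Gamma x a y b z ≤ Gamma z b y a x := by
    rintro x a y b z ω ⟨ξ, hξ, α, hα, η, hη, β, hβ, ζ, hζ, h1, h2, h3⟩
    exact ⟨ζ, hζ, β, hβ, η, hη, α, hα, ξ, hξ, h3, by rw [h2]; abel, h1⟩
  exact le_antisymm (le x a y b z) (le z b y a x)

/-- If `τ` is an involution compatible with `Γ`, then `Γ(x,a,y,τa,z)` is fixed by `τ`
whenever `x, y, z` are; moreover if also `τ(a) = a` then `Γ(x,a,y,a,z) = Γ(z,a,y,a,x)`. -/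
theorem stmt6 {R W : Type*} [Ring R] [AddCommGroup W] [Module R W]
    (τ : Submodule R W → Submodule R W)
    (hττ : ∀ s, τ (τ s) = s)
    (hτΓ : ∀ x a y b z : Submodule R W,
      τ (Gamma x a y b z) = Gamma (τ z) (τ a) (τ y) (τ b) (τ x)) :
    (∀ a x y z : Submodule R W, τ x = x → τ y = y → τ z = z →
      τ (Gamma x a y (τ a) z) = Gamma x a y (τ a) z) ∧
    (∀ a x y z : Submodule R W, τ a = a → τ x = x → τ y = y → τ z = z →
      Gamma x a y a z = Gamma z a y a x) := by
  refine ⟨fun a x y z hx hy hz => ?_, fun a x y z _ _ _ _ => Gamma_swap x a y a z⟩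
  rw [hτΓ, hττ, hx, hy, hz]
  exact Gamma_swap z (τ a) y a x
end

section
/- Let W be a module over a ring R. For every linear relation F on W and all submodules c, z of W, one has F ∘ P_z^c ∘ F⁻¹ = P_{F(z)}^{F(c)}, where F(z) and F(c) denote the images of z and c under F. -/
/-- Conjugation of a generalized projection by a linear relation:
`F ∘ P_z^c ∘ F⁻¹ = P_{F(z)}^{F(c)}`. -/
theorem stmt8 {R W : Type*} [Ring R] [AddCommGroup W] [Module R W]
    (F : Submodule R (W × W)) (c z : Submodule R W) :
    relComp F (relComp (genProj z c) (relInv F))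
      = genProj (relImage F z) (relImage F c) := by
  ext ⟨u, w⟩
  constructor
  · rintro ⟨v', ⟨v, hvu, hz, hc⟩, hvw⟩
    exact ⟨⟨v', hz, hvw⟩, v' - v, hc, F.sub_mem hvw hvu⟩
  · rintro ⟨⟨s, hs, hsw⟩, t, ht, htF⟩
    refine ⟨s, ⟨s - t, ?_, hs, ?_⟩, hsw⟩
    · show (s - t, u) ∈ F
      simpa using F.sub_mem hsw htF
    · simpa using ht
end

section
/- Let W be a module over a ring R. For all submodules x, a, y, b, z of W, one has Γ(x,a,y,b,z) = (1 − (P_a^x ∘ P_y^b))(z), i.e. Γ(x,a,y,b,z) is the image of z under the linear relation 1 − (P_a^x ∘ P_y^b). -/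
/-- `Γ(x,a,y,b,z) = (1 - (P_a^x ∘ P_y^b))(z)`. -/
theorem stmt10 {R W : Type*} [Ring R] [AddCommGroup W] [Module R W]
    (x a y b z : Submodule R W) :
    Gamma x a y b z = relImage (oneMinus (relComp (genProj a x) (genProj y b))) z := by
  ext ω
  constructor
  · rintro ⟨ξ, hξ, α, hα, η, hη, β, hβ, ζ, hζ, h1, h2, h3⟩
    have hαηξ : α = η + ξ := by
      apply add_left_cancel (a := ζ)
      rw [← h1, h2, add_assoc]
    have hβζη : β = ζ + η := by
      apply add_left_cancel (a := ξ)
      rw [← h3, h2, add_comm]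
    refine ⟨ζ, hζ, -α, ⟨-η, ⟨y.neg_mem hη, ?_⟩, a.neg_mem hα, ?_⟩, ?_⟩
    · have h : -η - ζ = -β := by rw [hβζη]; abel
      exact h ▸ b.neg_mem hβ
    · have h : -α - -η = -ξ := by rw [hαηξ]; abel
      exact h ▸ x.neg_mem hξ
    · simpa using h1
  · rintro ⟨ζ, hζ, w, ⟨η, ⟨hη, hβ⟩, hw, hξ⟩, h⟩
    replace h : ω = ζ - w := h
    refine ⟨-(w - η), x.neg_mem hξ, -w, a.neg_mem hw, -η, y.neg_mem hη, -(η - ζ),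
      b.neg_mem hβ, ζ, hζ, ?_, ?_, ?_⟩ <;> rw [h] <;> abel
end

section
/- Let W be a module over a ring R. For all submodules x, a, y, b, z of W, with L_{xayb} := 1 − (P_a^x ∘ P_y^b) and M_{xabz} := P_x^a − P_b^z, one has (L_{xayb})⁻¹(z) = L_{yaxb}(z), i.e. (1 − (P_a^x ∘ P_y^b))⁻¹(z) = (1 − (P_a^y ∘ P_x^b))(z), and (M_{xabz})⁻¹(y) = M_{zabx}(y), i.e. ((P_x^a − P_b^z)⁻¹)(y) = (P_z^a − P_b^x)(y). -/
/-- With `L_{xayb} = 1 - (P_a^x ∘ P_y^b)` and `M_{xabz} = P_x^a - P_b^z`, one has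
`(L_{xayb})⁻¹(z) = L_{yaxb}(z)` and `(M_{xabz})⁻¹(y) = M_{zabx}(y)`. -/
theorem stmt13 {R W : Type*} [Ring R] [AddCommGroup W] [Module R W]
    (x a y b z : Submodule R W) :
    relImage (relInv (oneMinus (relComp (genProj a x) (genProj y b)))) z
      = relImage (oneMinus (relComp (genProj a y) (genProj x b))) z ∧
    relImage (relInv (relSub (genProj x a) (genProj b z))) y
      = relImage (relSub (genProj z a) (genProj b x)) y := by
  constructor
  · ext ω
    constructor
    · rintro ⟨ζ, hζ, w, ⟨v, ⟨hv, hvb⟩, hw, hwv⟩, h⟩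
      change ζ = ω - w at h
      subst h
      refine ⟨ω - w, hζ, -w, ⟨v - w, ⟨?_, ?_⟩, ?_, ?_⟩, ?_⟩
      · simpa using neg_mem hwv
      · simpa using hvb
      · exact neg_mem hw
      · simpa [sub_eq_add_neg] using neg_mem hv
      · simp
    · rintro ⟨ζ, hζ, w, ⟨v, ⟨hv, hvb⟩, hw, hwv⟩, h⟩
      change ω = ζ - w at h
      subst h
      refine ⟨ζ, hζ, -w, ⟨v - w, ⟨?_, ?_⟩, ?_, ?_⟩, ?_⟩
      · simpa using neg_mem hwv
      · simpa using hvb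
      · exact neg_mem hw
      · simpa [sub_eq_add_neg] using neg_mem hv
      · simp
  · ext ω
    constructor
    · rintro ⟨η, hη, α, β, ⟨hα, hαa⟩, ⟨hβ, hβz⟩, h⟩
      change η = α - β at h
      subst h
      refine ⟨α - β, hη, ω - β, -β, ⟨?_, ?_⟩, ⟨neg_mem hβ, ?_⟩, ?_⟩
      · simpa using neg_mem hβz
      · simpa using neg_mem hαa
      · simpa [sub_eq_add_neg] using neg_mem hα
      · simp
    · rintro ⟨η, hη, α, β, ⟨hα, hαa⟩, ⟨hβ, hβx⟩, h⟩
      change ω = α - β at h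
      subst h
      refine ⟨η, hη, η - β, -β, ⟨?_, ?_⟩, ⟨neg_mem hβ, ?_⟩, ?_⟩
      · simpa using neg_mem hβx
      · simpa using neg_mem hαa
      · simpa [sub_eq_add_neg] using neg_mem hα
      · simp
end

section
/- Let K be a field with a ring involution σ, W a K-vector space, and β a σ-sesquilinear form on W. Then for all subspaces x, a of W, one has the inclusion P_{a^⊥}^{x^⊥} ⊆ (P_x^a)*. If moreover W is finite-dimensional and β is nondegenerate and ε-Hermitian (ε ∈ {1,−1}), then equality holds: (P_x^a)* = P_{a^⊥}^{x^⊥}. -/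
/-- Orthogonal complement `S^⊥ = {v | ∀ s ∈ S, β(v,s) = 0}` of a subspace with respect
to a sesquilinear form `β`. -/
def orthB {K W : Type*} [Field K] [AddCommGroup W] [Module K W] {σ : K →+* K}
    (β : W →ₛₗ[σ] W →ₗ[K] K) (S : Submodule K W) : Submodule K W where
  carrier := {v | ∀ s ∈ S, β v s = 0}
  zero_mem' := by intro s hs; simp
  add_mem' := by intro u v hu hv s hs; simp [hu s hs, hv s hs]
  smul_mem' := by intro c v hv s hs; simp [hv s hs]

/-- Adjoint `F* = {(v',w') | ∀ (v,w) ∈ F, β(v',w) = β(w',v)}` of a linear relation. -/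
def adjRel {K W : Type*} [Field K] [AddCommGroup W] [Module K W] {σ : K →+* K}
    (β : W →ₛₗ[σ] W →ₗ[K] K) (F : Submodule K (W × W)) : Submodule K (W × W) where
  carrier := {p | ∀ q ∈ F, β p.1 q.2 = β p.2 q.1}
  zero_mem' := by intro q hq; simp
  add_mem' := by intro p p' hp hp' q hq; simp [Prod.fst_add, Prod.snd_add, hp q hq, hp' q hq]
  smul_mem' := by intro c p hp q hq; simp [Prod.smul_fst, Prod.smul_snd, hp q hq]

/-- `P_{a^⊥}^{x^⊥} ⊆ (P_x^a)*` for any sesquilinear form; equality holds if `W` is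
finite-dimensional and `β` is nondegenerate and ε-Hermitian. -/
theorem stmt16 {K W : Type*} [Field K] [AddCommGroup W] [Module K W]
    (σ : K →+* K) (hσ : ∀ c, σ (σ c) = c)
    (β : W →ₛₗ[σ] W →ₗ[K] K) :
    (∀ x a : Submodule K W, genProj (orthB β a) (orthB β x) ≤ adjRel β (genProj x a)) ∧
    (FiniteDimensional K W →
      ∀ ε : K, (ε = 1 ∨ ε = -1) → (∀ v w, β v w = ε * σ (β w v)) →
      (∀ v, (∀ w, β v w = 0) → v = 0) → (∀ w, (∀ v, β v w = 0) → w = 0) →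
      ∀ x a : Submodule K W, adjRel β (genProj x a) = genProj (orthB β a) (orthB β x)) := by
  have hle (x a : Submodule K W) :
      genProj (orthB β a) (orthB β x) ≤ adjRel β (genProj x a) := by
    rintro ⟨v', w'⟩ ⟨hw, hvw⟩ ⟨v, w⟩ ⟨hx, ha⟩
    have h₁ : β w' (w - v) = 0 := hw _ ha
    have h₂ : β (w' - v') w = 0 := hvw _ hx
    rw [map_sub, sub_eq_zero] at h₁
    rw [map_sub, LinearMap.sub_apply, sub_eq_zero] at h₂
    exact h₂.symm.trans h₁
  refine ⟨hle, fun _ _ _ _ _ _ x a => le_antisymm ?_ (hle x a)⟩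
  rintro ⟨v', w'⟩ h
  refine ⟨fun s hs => ?_, fun s hs => ?_⟩
  · have h₀ : β v' 0 = β w' s := h (s, 0) ⟨x.zero_mem, by simpa using hs⟩
    simpa using h₀.symm
  · have h₀ : β v' s = β w' s := h (s, s) ⟨hs, by simp⟩
    simp [h₀]
end

section
/- Let K be a field with a ring involution σ, W a K-vector space, and β a nondegenerate ε-Hermitian σ-sesquilinear form on W (ε ∈ {1,−1}). Then for all subspaces x, a, y, b, z of W, one has the inclusion Γ(x^⊥, b^⊥, y^⊥, a^⊥, z^⊥) ⊆ (Γ(x, a, y, b, z))^⊥. -/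
/-- Theorem 5.6 (1): `Γ(x^⊥, b^⊥, y^⊥, a^⊥, z^⊥) ⊆ (Γ(x,a,y,b,z))^⊥` for a
nondegenerate ε-Hermitian sesquilinear form. -/
theorem stmt18 {K W : Type*} [Field K] [AddCommGroup W] [Module K W]
    (σ : K →+* K) (hσ : ∀ c, σ (σ c) = c)
    (β : W →ₛₗ[σ] W →ₗ[K] K)
    (ε : K) (hε : ε = 1 ∨ ε = -1)
    (hherm : ∀ v w, β v w = ε * σ (β w v))
    (hnd1 : ∀ v, (∀ w, β v w = 0) → v = 0)
    (hnd2 : ∀ w, (∀ v, β v w = 0) → w = 0)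
    (x a y b z : Submodule K W) :
    Gamma (orthB β x) (orthB β b) (orthB β y) (orthB β a) (orthB β z)
      ≤ orthB β (Gamma x a y b z) := by
  rintro ω' ⟨ξ', hξ', α', hα', η', hη', γ', hγ', ζ', hζ', h1', h2', h3'⟩
    ω ⟨ξ, hξ, α, hα, η, hη, γ, hγ, ζ, hζ, h1, h2, h3⟩
  obtain rfl : α' = η' + ξ' := by
    rw [h1', add_assoc] at h2'
    exact add_left_cancel h2'
  obtain rfl : γ' = ζ' + η' := by
    rw [h3', add_comm] at h2'
    exact add_right_cancel h2'
  obtain rfl : α = η + ξ := by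
    rw [h1, add_assoc] at h2
    exact add_left_cancel h2
  obtain rfl : γ = ζ + η := by
    rw [h3, add_comm] at h2
    exact add_right_cancel h2
  have hbγ := hα' _ hγ
  have haα := hγ' _ hα
  have hx := hξ' _ hξ
  have hy := hη' _ hη
  have hz := hζ' _ hζ
  rw [h2, h2']
  simp only [map_add, LinearMap.add_apply] at *
  linear_combination hbγ + haα + hx - hy + hz
end

section
/- Let K be a field with a ring involution σ, W a finite-dimensional K-vector space, and β a nondegenerate ε-Hermitian σ-sesquilinear form on W (ε ∈ {1,−1}). Then for all subspaces x, a, y, b, z of W, one has the equality Γ(x^⊥, b^⊥, y^⊥, a^⊥, z^⊥) = (Γ(x, a, y, b, z))^⊥; in particular, the orthocomplementation map x ↦ x^⊥ is an involution of the Grassmannian geometry of W, i.e. a bijection of order two satisfying τ(Γ(x,a,y,b,z)) = Γ(τ(z), τ(a), τ(y), τ(b), τ(x)) for τ(x) = x^⊥ (using Γ(x^⊥,b^⊥,y^⊥,a^⊥,z^⊥) = Γ(z^⊥,a^⊥,y^⊥,b^⊥,x^⊥)). -/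
theorem mem_Gamma {R W : Type*} [Ring R] [AddCommGroup W] [Module R W]
    {x a y b z : Submodule R W} {ω : W} :
    ω ∈ Gamma x a y b z ↔
      ∃ ξ ∈ x, ∃ ζ ∈ z, ω - ζ ∈ a ∧ ω - ζ - ξ ∈ y ∧ ω - ξ ∈ b := by
  constructor
  · rintro ⟨ξ, hξ, α, hα, η, hη, β, hβ, ζ, hζ, h1, h2, h3⟩
    refine ⟨ξ, hξ, ζ, hζ, ?_, ?_, ?_⟩
    · simpa [h1] using hα
    · rwa [show ω - ζ - ξ = η by rw [h2]; abel]
    · simpa [h3] using hβ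
  · rintro ⟨ξ, hξ, ζ, hζ, h1, h2, h3⟩
    exact ⟨ξ, hξ, _, h1, _, h2, _, h3, ζ, hζ, by abel, by abel, by abel⟩

theorem surjective_of_separatingRight {K W : Type*} [Field K] [AddCommGroup W] [Module K W]
    [FiniteDimensional K W] {σ : K →+* K} [RingHomSurjective σ]
    (β : W →ₛₗ[σ] W →ₗ[K] K) (h : ∀ w, (∀ v, β v w = 0) → w = 0) :
    Function.Surjective β := by
  let Φ : Submodule K (Module.Dual K W) := LinearMap.range β
  have hΦ : Φ.dualCoannihilator = ⊥ := by
    rw [eq_bot_iff]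
    intro w hw
    rw [Submodule.mem_dualCoannihilator] at hw
    exact h w fun v => hw (β v) ⟨v, rfl⟩
  have htop : Φ = ⊤ := by
    rw [← Subspace.dualCoannihilator_dualAnnihilator_eq (W := Φ), hΦ,
      Submodule.dualAnnihilator_bot]
  exact LinearMap.range_eq_top.1 htop

theorem orthB_orthB {K W : Type*} [Field K] [AddCommGroup W] [Module K W]
    {σ : K →+* K} {β : W →ₛₗ[σ] W →ₗ[K] K} (hrefl : ∀ v w, β v w = 0 → β w v = 0)
    (hsurj : Function.Surjective β) (x : Submodule K W) : orthB β (orthB β x) = x := by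
  refine le_antisymm (fun w hw => ?_) fun w hw u hu => hrefl _ _ (hu w hw)
  by_contra hwx
  obtain ⟨f, hfw, hfx⟩ := Submodule.exists_le_ker_of_notMem hwx
  obtain ⟨u, rfl⟩ := hsurj f
  exact hfw (hrefl _ _ (hw u fun s hs => hfx hs))

/-- A functional vanishing on `Gamma x a y b z` decomposes along functionals vanishing on the
five subspaces. -/
theorem exists_dual_of_vanish_Gamma {K W : Type*} [Field K] [AddCommGroup W] [Module K W]
    {x a y b z : Submodule K W} {φ : Module.Dual K W} (hφ : ∀ ω ∈ Gamma x a y b z, φ ω = 0) :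
    ∃ f ∈ x.dualAnnihilator, ∃ g ∈ z.dualAnnihilator, φ - f ∈ a.dualAnnihilator ∧
      φ - g ∈ b.dualAnnihilator ∧ φ - g - f ∈ y.dualAnnihilator := by
  let p₁ : W × W × W →ₗ[K] W := LinearMap.fst K W (W × W)
  let p₂ : W × W × W →ₗ[K] W := LinearMap.fst K W W ∘ₗ LinearMap.snd K W (W × W)
  let p₃ : W × W × W →ₗ[K] W := LinearMap.snd K W W ∘ₗ LinearMap.snd K W (W × W)
  let F : W × W × W →ₗ[K] (W ⧸ x) × (W ⧸ z) × (W ⧸ a) × (W ⧸ y) × (W ⧸ b) :=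
    (x.mkQ ∘ₗ p₂).prod <| (z.mkQ ∘ₗ p₃).prod <| (a.mkQ ∘ₗ (p₁ - p₃)).prod <|
      (y.mkQ ∘ₗ (p₁ - p₃ - p₂)).prod (b.mkQ ∘ₗ (p₁ - p₂))
  have hker : φ ∘ₗ p₁ ∈ (LinearMap.ker F).dualAnnihilator := by
    rw [Submodule.mem_dualAnnihilator]
    rintro ⟨ω, ξ, ζ⟩ h
    simp only [F, p₁, p₂, p₃, LinearMap.mem_ker, LinearMap.prod_apply, Function.prod, Prod.mk_eq_zero,
      LinearMap.comp_apply, LinearMap.sub_apply, LinearMap.fst_apply, LinearMap.snd_apply,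
      Submodule.mkQ_apply, Submodule.Quotient.mk_eq_zero] at h
    exact hφ ω (mem_Gamma.2 ⟨ξ, h.1, ζ, h.2.1, h.2.2.1, h.2.2.2.1, h.2.2.2.2⟩)
  rw [← LinearMap.range_dualMap_eq_dualAnnihilator_ker] at hker
  obtain ⟨G, hG⟩ := hker
  have hG' (ω ξ ζ : W) : G (x.mkQ ξ, z.mkQ ζ, a.mkQ (ω - ζ), y.mkQ (ω - ζ - ξ), b.mkQ (ω - ξ))
      = φ ω := LinearMap.congr_fun hG (ω, ξ, ζ)
  let fx : Module.Dual K W := G ∘ₗ LinearMap.inl .. ∘ₗ x.mkQ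
  let fz : Module.Dual K W := G ∘ₗ LinearMap.inr .. ∘ₗ LinearMap.inl .. ∘ₗ z.mkQ
  let fa : Module.Dual K W :=
    G ∘ₗ LinearMap.inr .. ∘ₗ LinearMap.inr .. ∘ₗ LinearMap.inl .. ∘ₗ a.mkQ
  let fy : Module.Dual K W := G ∘ₗ LinearMap.inr .. ∘ₗ LinearMap.inr .. ∘ₗ LinearMap.inr ..
    ∘ₗ LinearMap.inl .. ∘ₗ y.mkQ
  let fb : Module.Dual K W := G ∘ₗ LinearMap.inr .. ∘ₗ LinearMap.inr .. ∘ₗ LinearMap.inr ..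
    ∘ₗ LinearMap.inr .. ∘ₗ b.mkQ
  have hsum (ω ξ ζ : W) :
      fx ξ + fz ζ + fa (ω - ζ) + fy (ω - ζ - ξ) + fb (ω - ξ) = φ ω := by
    rw [← hG' ω ξ ζ]
    simp only [fx, fz, fa, fy, fb, LinearMap.comp_apply, LinearMap.inl_apply,
      LinearMap.inr_apply, ← map_add, Prod.mk_add_mk, add_zero, zero_add]
  have hx : fx ∈ x.dualAnnihilator := by
    rw [Submodule.mem_dualAnnihilator]
    intro w hw
    simp only [fx, LinearMap.comp_apply, Submodule.mkQ_apply,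
      (Submodule.Quotient.mk_eq_zero x).2 hw, map_zero]
  have hz : fz ∈ z.dualAnnihilator := by
    rw [Submodule.mem_dualAnnihilator]
    intro w hw
    simp only [fz, LinearMap.comp_apply, Submodule.mkQ_apply,
      (Submodule.Quotient.mk_eq_zero z).2 hw, map_zero]
  have ha : fa ∈ a.dualAnnihilator := by
    rw [Submodule.mem_dualAnnihilator]
    intro w hw
    simp only [fa, LinearMap.comp_apply, Submodule.mkQ_apply,
      (Submodule.Quotient.mk_eq_zero a).2 hw, map_zero]
  have hy : fy ∈ y.dualAnnihilator := by
    rw [Submodule.mem_dualAnnihilator]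
    intro w hw
    simp only [fy, LinearMap.comp_apply, Submodule.mkQ_apply,
      (Submodule.Quotient.mk_eq_zero y).2 hw, map_zero]
  have hb : fb ∈ b.dualAnnihilator := by
    rw [Submodule.mem_dualAnnihilator]
    intro w hw
    simp only [fb, LinearMap.comp_apply, Submodule.mkQ_apply,
      (Submodule.Quotient.mk_eq_zero b).2 hw, map_zero]
  have e₁ (w : W) : fa w + fy w + fb w = φ w := by simpa using hsum w 0 0
  have e₂ (w : W) : fx w - fy w - fb w = 0 := by simpa [sub_eq_add_neg] using hsum 0 w 0
  have e₃ (w : W) : fz w - fa w - fy w = 0 := by simpa [sub_eq_add_neg] using hsum 0 0 w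
  refine ⟨fx, hx, fz, hz, ?_, ?_, ?_⟩
  · convert ha using 1
    ext w
    simp only [LinearMap.sub_apply]
    linear_combination -e₁ w - e₂ w
  · convert hb using 1
    ext w
    simp only [LinearMap.sub_apply]
    linear_combination -e₁ w - e₃ w
  · convert neg_mem hy using 1
    ext w
    simp only [LinearMap.sub_apply, LinearMap.neg_apply]
    linear_combination -e₁ w - e₃ w - e₂ w

theorem Gamma_orthB {K W : Type*} [Field K] [AddCommGroup W] [Module K W]
    {σ : K →+* K} {β : W →ₛₗ[σ] W →ₗ[K] K} (hsurj : Function.Surjective β)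
    (x a y b z : Submodule K W) :
    Gamma (orthB β x) (orthB β b) (orthB β y) (orthB β a) (orthB β z)
      = orthB β (Gamma x a y b z) := by
  refine le_antisymm (fun v hv ω hω => ?_) fun v hv => ?_
  · obtain ⟨ξ', hξ', ζ', hζ', hβ', hη', hα'⟩ := mem_Gamma.1 hv
    obtain ⟨ξ, hξ, ζ, hζ, hα, hη, hβ⟩ := mem_Gamma.1 hω
    have e₁ := hα' _ hα
    have e₂ := hη' _ hη
    have e₃ := hβ' _ hβ
    have e₄ := hξ' _ hξ
    have e₅ := hζ' _ hζ
    simp only [map_sub, LinearMap.sub_apply] at e₁ e₂ e₃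
    linear_combination e₁ + e₃ - e₂ + e₄ + e₅
  · obtain ⟨f, hf, g, hg, ha, hb, hy⟩ := exists_dual_of_vanish_Gamma hv
    obtain ⟨ξ, rfl⟩ := hsurj f
    obtain ⟨ζ, rfl⟩ := hsurj g
    rw [Submodule.mem_dualAnnihilator] at hf hg ha hb hy
    simp only [← map_sub] at ha hb hy
    exact mem_Gamma.2 ⟨ξ, hf, ζ, hg, hb, hy, ha⟩

/-- Theorem 5.6 (2): in finite dimension, `Γ(x^⊥, b^⊥, y^⊥, a^⊥, z^⊥) = (Γ(x,a,y,b,z))^⊥`;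
in particular orthocomplementation is an involution of the Grassmannian geometry. -/
theorem stmt19 {K W : Type*} [Field K] [AddCommGroup W] [Module K W]
    [FiniteDimensional K W]
    (σ : K →+* K) (hσ : ∀ c, σ (σ c) = c)
    (β : W →ₛₗ[σ] W →ₗ[K] K)
    (ε : K) (hε : ε = 1 ∨ ε = -1)
    (hherm : ∀ v w, β v w = ε * σ (β w v))
    (hnd1 : ∀ v, (∀ w, β v w = 0) → v = 0)
    (hnd2 : ∀ w, (∀ v, β v w = 0) → w = 0) :
    (∀ x a y b z : Submodule K W,
      Gamma (orthB β x) (orthB β b) (orthB β y) (orthB β a) (orthB β z)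
        = orthB β (Gamma x a y b z)) ∧
    Function.Bijective (orthB β) ∧
    (∀ x : Submodule K W, orthB β (orthB β x) = x) ∧
    (∀ x a y b z : Submodule K W,
      orthB β (Gamma x a y b z)
        = Gamma (orthB β z) (orthB β a) (orthB β y) (orthB β b) (orthB β x)) := by
  have : RingHomSurjective σ := ⟨fun c => ⟨σ c, hσ c⟩⟩
  have hsurj : Function.Surjective β := surjective_of_separatingRight β hnd2
  have hinv : Function.Involutive (orthB β) :=
    orthB_orthB (fun v w h => by rw [hherm w v, h, map_zero, mul_zero]) hsurj
  refine ⟨Gamma_orthB hsurj, hinv.bijective, hinv, fun x a y b z => ?_⟩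
  rw [← Gamma_orthB hsurj, Gamma_swap]
end
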